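/- Let F_a and F_b be real polynomials of total degree at most 2 in two variables, let p = (c,d) and q = (e,f) be two points of ℝ², let ι_p and ι_q be the generalised Manin involutions with degree parameter D = 2 and involution points p and q respectively, and let τ = ι_q ∘ ι_p. Let L(u,v) = (d−f)(u−e) − (c−e)(v−f), so L = 0 is the line through p and q. Then at every point (u,v) at which the defining denominators of ι_p at (u,v) and of ι_q at ι_p(u,v) are nonzero and at which L(u,v)·F_a(u,v) ≠ 0 and L(τ(u,v))·F_a(τ(u,v)) ≠ 0, the map τ is differentiable and the determinant of its total derivative equals (L(τ(u,v))·F_a(τ(u,v))) / (L(u,v)·F_a(u,v)); that is, τ is measure preserving with density 1/(L·F_a). -/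

import Mathlib

open MvPolynomial

/-- Evaluation of a bivariate polynomial at a point of the plane. -/
noncomputable def pev (F : MvPolynomial (Fin 2) ℝ) (w : ℝ × ℝ) : ℝ :=
  eval ![w.1, w.2] F

/-- First directional quantity `F⁽¹⁾ = (c−u)Fᵤ + (d−v)Fᵥ` at `w = (u,v)`, direction point `p = (c,d)`. -/
noncomputable def d1 (F : MvPolynomial (Fin 2) ℝ) (p w : ℝ × ℝ) : ℝ :=
  (p.1 - w.1) * pev (pderiv (0 : Fin 2) F) w + (p.2 - w.2) * pev (pderiv (1 : Fin 2) F) w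

/-- Second directional quantity `F⁽²⁾` at `w = (u,v)`, direction point `p = (c,d)`. -/
noncomputable def d2 (F : MvPolynomial (Fin 2) ℝ) (p w : ℝ × ℝ) : ℝ :=
  (p.1 - w.1) ^ 2 * pev (pderiv (0 : Fin 2) (pderiv (0 : Fin 2) F)) w
    + 2 * (p.1 - w.1) * (p.2 - w.2) * pev (pderiv (1 : Fin 2) (pderiv (0 : Fin 2) F)) w
    + (p.2 - w.2) ^ 2 * pev (pderiv (1 : Fin 2) (pderiv (1 : Fin 2) F)) w

/-- `G₁ = F_a·F_b⁽¹⁾ − F_a⁽¹⁾·F_b`. -/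
noncomputable def G1 (Fa Fb : MvPolynomial (Fin 2) ℝ) (p w : ℝ × ℝ) : ℝ :=
  pev Fa w * d1 Fb p w - d1 Fa p w * pev Fb w

/-- `G₂ = F_a·F_b⁽²⁾ − F_a⁽²⁾·F_b`. -/
noncomputable def G2 (Fa Fb : MvPolynomial (Fin 2) ℝ) (p w : ℝ × ℝ) : ℝ :=
  pev Fa w * d2 Fb p w - d2 Fa p w * pev Fb w

/-- The defining denominator `2(2−D)G₁ − G₂` of the generalised Manin involution. -/
noncomputable def den (Fa Fb : MvPolynomial (Fin 2) ℝ) (D : ℕ) (p w : ℝ × ℝ) : ℝ :=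
  2 * (2 - (D : ℝ)) * G1 Fa Fb p w - G2 Fa Fb p w

/-- The generalised Manin involution `ι_p(u,v) = (u,v) + z·(p − (u,v))`
with `z = 2G₁ / (2(2−D)G₁ − G₂)`. -/
noncomputable def manin (Fa Fb : MvPolynomial (Fin 2) ℝ) (D : ℕ) (p w : ℝ × ℝ) : ℝ × ℝ :=
  w + (2 * G1 Fa Fb p w / den Fa Fb D p w) • (p - w)

/-- The linear form `L(u,v) = (d−f)(u−e) − (c−e)(v−f)` whose zero set is the line
through `p = (c,d)` and `q = (e,f)`. -/
noncomputable def lineThrough (p q w : ℝ × ℝ) : ℝ :=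
  (p.2 - q.2) * (w.1 - q.1) - (p.1 - q.1) * (w.2 - q.2)

/-- The general bivariate polynomial of total degree at most two. -/
lemma exists_quadratic_coeffs (F : MvPolynomial (Fin 2) ℝ) (hF : F.totalDegree ≤ 2) :
    ∃ a b c d e f : ℝ, F = C a + C b * X 0 + C c * X 1 + C d * (X 0 * X 0) + C e * (X 0 * X 1)
      + C f * (X 1 * X 1) := by
  rw [F.as_sum]
  refine Finset.sum_induction _ (fun G : MvPolynomial (Fin 2) ℝ => ∃ a b c d e f : ℝ,
    G = C a + C b * X 0 + C c * X 1 + C d * (X 0 * X 0) + C e * (X 0 * X 1) + C f * (X 1 * X 1)) ?_ ?_ ?_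
  · rintro _ _ ⟨a, b, c, d, e, f, rfl⟩ ⟨a', b', c', d', e', f', rfl⟩
    refine ⟨a + a', b + b', c + c', d + d', e + e', f + f', ?_⟩
    simp only [map_add]
    ring
  · exact ⟨0, 0, 0, 0, 0, 0, by simp⟩
  · intro s hs
    have hdeg : s 0 + s 1 ≤ 2 := by
      have h := (le_totalDegree hs).trans hF
      rwa [Finsupp.sum_fintype _ _ (fun _ => rfl), Fin.sum_univ_two] at h
    rw [monomial_eq, Finsupp.prod_fintype _ _ (fun _ => pow_zero _), Fin.prod_univ_two]
    generalize coeff s F = k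
    generalize s 0 = m at *
    generalize s 1 = n at *
    have hm : m ≤ 2 := by omega
    have hn : n ≤ 2 := by omega
    interval_cases m <;> interval_cases n <;> try omega
    · exact ⟨k, 0, 0, 0, 0, 0, by simp⟩
    · exact ⟨0, 0, k, 0, 0, 0, by simp⟩
    · exact ⟨0, 0, 0, 0, 0, k, by simp [sq]⟩
    · exact ⟨0, k, 0, 0, 0, 0, by simp⟩
    · exact ⟨0, 0, 0, 0, k, 0, by simp⟩
    · exact ⟨0, 0, 0, k, 0, 0, by simp [sq]⟩

/-- For a polynomial of degree at most two, the value and the directional quantities are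
differentiable, and along the line through `w` and `p` they are given by Taylor's formula. -/
lemma quadratic_differentiable_and_taylor (F : MvPolynomial (Fin 2) ℝ) (hF : F.totalDegree ≤ 2)
    (p : ℝ × ℝ) :
    (Differentiable ℝ (pev F) ∧ Differentiable ℝ (d1 F p) ∧ Differentiable ℝ (d2 F p)) ∧
    ∀ (w : ℝ × ℝ) (t : ℝ),
      pev F (w + t • (p - w)) = pev F w + t * d1 F p w + t ^ 2 / 2 * d2 F p w ∧
      d1 F p (w + t • (p - w)) = (1 - t) * (d1 F p w + t * d2 F p w) ∧
      d2 F p (w + t • (p - w)) = (1 - t) ^ 2 * d2 F p w := by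
  obtain ⟨a, b, c, d, e, f, rfl⟩ := exists_quadratic_coeffs F hF
  refine ⟨⟨?_, ?_, ?_⟩, fun w t => ⟨?_, ?_, ?_⟩⟩
  · unfold pev
    simp
    fun_prop
  · unfold d1 pev
    simp [pderiv_X]
    fun_prop
  · unfold d2 pev
    simp [pderiv_X]
    fun_prop
  all_goals
    simp [pev, d1, d2, pderiv_X]
    ring

/-- Derivatives at `w` of the value and the directional quantities along the line from `w` to `p`. -/
lemma quadratic_hasDerivAt_line (F : MvPolynomial (Fin 2) ℝ) (hF : F.totalDegree ≤ 2)
    (p w : ℝ × ℝ) :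
    HasDerivAt (fun t : ℝ => pev F (w + t • (p - w))) (d1 F p w) 0 ∧
    HasDerivAt (fun t : ℝ => d1 F p (w + t • (p - w))) (d2 F p w - d1 F p w) 0 ∧
    HasDerivAt (fun t : ℝ => d2 F p (w + t • (p - w))) (-2 * d2 F p w) 0 := by
  have taylor := (quadratic_differentiable_and_taylor F hF p).2 w
  simp only [taylor]
  have ht := hasDerivAt_id (0 : ℝ)
  refine ⟨?_, ?_, ?_⟩
  · exact (((ht.mul_const (d1 F p w)).const_add (pev F w)).add
      (((ht.pow 2).div_const 2).mul_const (d2 F p w))).congr_deriv (by simp)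
  · exact ((ht.const_sub 1).mul ((ht.mul_const (d2 F p w)).const_add (d1 F p w))).congr_deriv
      (by simp; ring)
  · exact (((ht.const_sub 1).pow 2).mul_const (d2 F p w)).congr_deriv (by simp)

/-- Determinant of a rank-one perturbation of a homothety of the plane. -/
lemma det_smul_id_add_smulRight (s : ℝ) (φ : ℝ × ℝ →L[ℝ] ℝ) (v : ℝ × ℝ) :
    (s • ContinuousLinearMap.id ℝ (ℝ × ℝ) + φ.smulRight v).det = s * (s + φ v) := by
  have hv : φ v = v.1 * φ (1, 0) + v.2 * φ (0, 1) := by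
    conv_lhs => rw [show v = v.1 • ((1, 0) : ℝ × ℝ) + v.2 • ((0, 1) : ℝ × ℝ) by ext <;> simp]
    simp only [map_add, map_smul, smul_eq_mul]
  rw [ContinuousLinearMap.det, ← LinearMap.det_toMatrix (Module.Basis.finTwoProd ℝ),
    Matrix.det_fin_two, hv]
  simp [LinearMap.toMatrix_apply]
  ring

lemma lineThrough_left (p q w : ℝ × ℝ) (t : ℝ) :
    lineThrough p q (w + t • (p - w)) = (1 - t) * lineThrough p q w := by
  simp [lineThrough]
  ring

lemma lineThrough_right (p q w : ℝ × ℝ) (t : ℝ) :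
    lineThrough p q (w + t • (q - w)) = (1 - t) * lineThrough p q w := by
  simp [lineThrough]
  ring

/-- The Jacobian determinant of the Manin involution of a quadratic pencil: the parameter `z`
satisfies `det Dι = -(1 - z) F(ι w) / F(w)`. -/
lemma exists_hasFDerivAt_manin (Fa Fb : MvPolynomial (Fin 2) ℝ)
    (hFa : Fa.totalDegree ≤ 2) (hFb : Fb.totalDegree ≤ 2) (p w : ℝ × ℝ)
    (hden : den Fa Fb 2 p w ≠ 0) :
    ∃ M : ℝ × ℝ →L[ℝ] ℝ × ℝ, HasFDerivAt (manin Fa Fb 2 p) M w ∧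
      M.det * pev Fa w =
        -((1 - 2 * G1 Fa Fb p w / den Fa Fb 2 p w) * pev Fa (manin Fa Fb 2 p w)) := by
  obtain ⟨⟨ha0, ha1, ha2⟩, ta⟩ := quadratic_differentiable_and_taylor Fa hFa p
  obtain ⟨⟨hb0, hb1, hb2⟩, _⟩ := quadratic_differentiable_and_taylor Fb hFb p
  set g : ℝ × ℝ → ℝ := fun x => 2 * G1 Fa Fb p x / den Fa Fb 2 p x with hg
  have hgd : DifferentiableAt ℝ g w := by
    have hn : DifferentiableAt ℝ (fun x => 2 * G1 Fa Fb p x) w := by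
      unfold G1
      fun_prop
    have hd : DifferentiableAt ℝ (den Fa Fb 2 p) w := by
      unfold den G1 G2
      fun_prop
    exact hn.mul (hd.inv hden)
  obtain ⟨φ, hφ⟩ := hgd
  have hM : HasFDerivAt (manin Fa Fb 2 p)
      ((1 - g w) • ContinuousLinearMap.id ℝ (ℝ × ℝ) + φ.smulRight (p - w)) w := by
    have hsub : HasFDerivAt (fun x : ℝ × ℝ => p - x) (-ContinuousLinearMap.id ℝ (ℝ × ℝ)) w :=
      (hasFDerivAt_id w).const_sub p
    have hadd := (hasFDerivAt_id (𝕜 := ℝ) w).add (hφ.smul hsub)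
    refine hadd.congr_fderiv ?_
    ext <;> simp <;> ring
  refine ⟨_, hM, ?_⟩
  have hline : HasDerivAt (fun t : ℝ => w + t • (p - w)) (p - w) 0 := by
    simpa using ((hasDerivAt_id (0 : ℝ)).smul_const (p - w)).const_add w
  have hφv : HasDerivAt (fun t : ℝ => g (w + t • (p - w))) (φ (p - w)) 0 :=
    HasFDerivAt.comp_hasDerivAt (l := g) (l' := φ) (0 : ℝ) (by simpa using hφ) hline
  obtain ⟨la0, la1, la2⟩ := quadratic_hasDerivAt_line Fa hFa p w
  obtain ⟨lb0, lb1, lb2⟩ := quadratic_hasDerivAt_line Fb hFb p w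
  have hnum := ((la0.mul lb1).sub (la1.mul lb0)).const_mul 2
  have hdenom := ((la0.mul lb2).sub (la2.mul lb0)).neg
  have hden' : den Fa Fb 2 p = fun x => -(pev Fa x * d2 Fb p x - d2 Fa p x * pev Fb x) := by
    funext x
    simp [den, G2]
  have hquot : HasDerivAt (fun t : ℝ => g (w + t • (p - w))) _ 0 :=
    (hnum.div hdenom (by simpa [hden'] using hden)).congr_of_eventuallyEq
      (.of_forall fun t => by simp [hg, hden', G1])
  have hFw : pev Fa (manin Fa Fb 2 p w) = _ := (ta w _).1
  rw [det_smul_id_add_smulRight, hφv.unique hquot, hFw]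
  simp only [hden'] at hden
  simp only [hg, hden', G1, zero_smul, add_zero, Pi.mul_apply, Pi.sub_apply, Pi.neg_apply]
  generalize pev Fa w = a0 at *
  generalize d1 Fa p w = a1 at *
  generalize d2 Fa p w = a2 at *
  generalize pev Fb w = b0 at *
  generalize d1 Fb p w = b1 at *
  generalize d2 Fb p w = b2 at *
  obtain ⟨δ, hδ⟩ : ∃ δ, δ = a0 * b2 - a2 * b0 := ⟨_, rfl⟩
  rw [← hδ] at hden ⊢
  replace hden := neg_ne_zero.mp hden
  clear * - hden hδ
  field_simp
  rw [hδ]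
  ring

/-- for a quadratic pencil, the generalised Manin transformation
`τ = ι_q ∘ ι_p` (with `D = 2`) is measure preserving with density `1/(L·F_a)`:
wherever defined, `det (Dτ) = (L(τ(w))·F_a(τ(w))) / (L(w)·F_a(w))`. -/
theorem manin_transformation_measure_preserving_quadratic
    (Fa Fb : MvPolynomial (Fin 2) ℝ)
    (hFa : Fa.totalDegree ≤ 2) (hFb : Fb.totalDegree ≤ 2)
    (p q : ℝ × ℝ)
    (τ : ℝ × ℝ → ℝ × ℝ) (hτ : τ = fun w => manin Fa Fb 2 q (manin Fa Fb 2 p w))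
    (w : ℝ × ℝ)
    (hden1 : den Fa Fb 2 p w ≠ 0)
    (hden2 : den Fa Fb 2 q (manin Fa Fb 2 p w) ≠ 0)
    (hρ : lineThrough p q w * pev Fa w ≠ 0)
    (hρ' : lineThrough p q (τ w) * pev Fa (τ w) ≠ 0) :
    DifferentiableAt ℝ τ w ∧
      (fderiv ℝ τ w).det =
        (lineThrough p q (τ w) * pev Fa (τ w)) / (lineThrough p q w * pev Fa w) := by
  obtain ⟨M, hM, hMdet⟩ := exists_hasFDerivAt_manin Fa Fb hFa hFb p w hden1
  obtain ⟨N, hN, hNdet⟩ := exists_hasFDerivAt_manin Fa Fb hFa hFb q _ hden2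
  have hNM : HasFDerivAt τ (N.comp M) w := hτ ▸ hN.comp w hM
  refine ⟨hNM.differentiableAt, ?_⟩
  have hdet : (N.comp M).det = N.det * M.det := LinearMap.det_comp _ _
  have hLp : lineThrough p q (manin Fa Fb 2 p w) = _ := lineThrough_left p q w _
  have hLq : lineThrough p q (manin Fa Fb 2 q (manin Fa Fb 2 p w)) = _ :=
    lineThrough_right p q _ _
  rw [hNM.fderiv, hdet, eq_div_iff hρ]
  subst hτ
  dsimp only
  rw [hLq, hLp]
  linear_combination N.det * lineThrough p q w * hMdet -
    (1 - 2 * G1 Fa Fb p w / den Fa Fb 2 p w) * lineThrough p q w * hNdet
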